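/- Let α ∈ [1/2, 1) ∪ (1, ∞), let ρ be a positive semidefinite complex n×n matrix with ρ ≠ 0, and let σ, σ' be positive semidefinite complex n×n matrices with σ' − σ positive semidefinite. Then D̃_α(ρ‖σ') ≤ D̃_α(ρ‖σ) in ℝ ∪ {+∞}. -/

import Mathlib

open Matrix
open scoped Kronecker Classical ComplexOrder

/-- Real power of a matrix via functional calculus on the eigenvalues of a Hermitian
matrix, with the convention that eigenvalue `0` is mapped to `0` (powers are taken on
the support). Non-Hermitian matrices are mapped to `0`. -/
noncomputable def matPow {n : Type*} [Fintype n] [DecidableEq n]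
    (A : Matrix n n ℂ) (t : ℝ) : Matrix n n ℂ :=
  if hA : A.IsHermitian then
    (hA.eigenvectorUnitary : Matrix n n ℂ) *
      Matrix.diagonal (fun i =>
        ((if hA.eigenvalues i = 0 then (0 : ℝ) else hA.eigenvalues i ^ t : ℝ) : ℂ)) *
      (star (hA.eigenvectorUnitary : Matrix n n ℂ))
  else 0

/-- `dominates σ ρ` (written `σ ≫ ρ` in the paper): the kernel of `σ` is contained in
the kernel of `ρ`. -/
def dominates {n : Type*} [Fintype n] (σ ρ : Matrix n n ℂ) : Prop :=
  ∀ v : n → ℂ, σ.mulVec v = 0 → ρ.mulVec v = 0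

/-- The sandwiched Rényi divergence of order `α`, with values in `ℝ ∪ {+∞}` (as a
subset of `EReal`), logarithms base 2. It is `+∞` unless `ρ` is not orthogonal to `σ`
(i.e. `Tr[ρσ] ≠ 0`) and (`σ ≫ ρ` or `α < 1`). -/
noncomputable def Dtilde {n : Type*} [Fintype n] [DecidableEq n]
    (α : ℝ) (ρ σ : Matrix n n ℂ) : EReal :=
  if (ρ * σ).trace ≠ 0 ∧ (dominates σ ρ ∨ α < 1) then
    (((α - 1)⁻¹ * Real.logb 2
        ((matPow (matPow σ ((1 - α) / (2 * α)) * ρ * matPow σ ((1 - α) / (2 * α))) α).trace.re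
          / ρ.trace.re) : ℝ) : EReal)
  else ⊤

namespace Matrix

open scoped MatrixOrder Matrix.Norms.L2Operator

section

variable {n : Type*} [Fintype n] {A B : Matrix n n ℂ}

lemma PosSemidef.trace_re_nonneg (hA : A.PosSemidef) : 0 ≤ A.trace.re :=
  (Complex.le_def.mp hA.trace_nonneg).1

lemma trace_re_mono (hAB : A ≤ B) : A.trace.re ≤ B.trace.re := by
  have := PosSemidef.trace_re_nonneg (le_iff.mp hAB)
  rw [trace_sub, Complex.sub_re] at this
  linarith

lemma PosSemidef.trace_re_pos (hA : A.PosSemidef) (h : A ≠ 0) : 0 < A.trace.re := by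
  refine lt_of_le_of_ne hA.trace_re_nonneg fun h0 => h (hA.trace_eq_zero_iff.mp ?_)
  exact Complex.ext h0.symm (Complex.le_def.mp hA.trace_nonneg).2.symm

/-- Antitonicity of the generalized inverse on matrices supported below the smaller one: if
`A ≤ B`, `A * X = C` and `B * Y = C`, then `Cᴴ * Y ≤ Cᴴ * X`. -/
lemma PosSemidef.conjTranspose_mul_le_of_mul_eq (hA : A.PosSemidef) (hB : B.PosSemidef)
    (hAB : A ≤ B) {C X Y : Matrix n n ℂ} (hX : A * X = C) (hY : B * Y = C) :
    Cᴴ * Y ≤ Cᴴ * X := by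
  have h₁ := hA.conjTranspose_mul_mul_same (X - Y)
  have h₂ := (le_iff.mp hAB).conjTranspose_mul_mul_same Y
  have hCX : Xᴴ * A = Cᴴ := by rw [← hX, conjTranspose_mul, hA.1.eq]
  have hCY : Yᴴ * B = Cᴴ := by rw [← hY, conjTranspose_mul, hB.1.eq]
  have hYC : Yᴴ * C = Cᴴ * Y := by rw [← hCY, Matrix.mul_assoc, hY]
  have key : Cᴴ * X - Cᴴ * Y = (X - Y)ᴴ * A * (X - Y) + Yᴴ * (B - A) * Y := by
    rw [conjTranspose_sub, Matrix.sub_mul, hCX, Matrix.mul_sub, Matrix.sub_mul, Matrix.sub_mul,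
      Matrix.mul_sub, Matrix.sub_mul, hCY, Matrix.mul_assoc Yᴴ A X, hX, hYC]
    abel
  rw [le_iff, key]
  exact h₁.add h₂

lemma PosSemidef.mulVec_eq_zero_of_le (hA : A.PosSemidef) (hAB : A ≤ B) {v : n → ℂ}
    (hv : B *ᵥ v = 0) : A *ᵥ v = 0 := by
  rw [← hA.dotProduct_mulVec_zero_iff]
  refine le_antisymm ?_ (hA.dotProduct_mulVec_nonneg v)
  have h := (le_iff.mp hAB).dotProduct_mulVec_nonneg v
  rw [sub_mulVec, hv, dotProduct_sub, dotProduct_zero, zero_sub] at h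
  exact neg_nonneg.mp h

end

section

variable {n : Type*} [Fintype n] [DecidableEq n] {A B : Matrix n n ℂ}

/-- The scalar function applied to the eigenvalues by `matPow`. -/
noncomputable def supportRpow (t x : ℝ) : ℝ := if x = 0 then 0 else x ^ t

lemma supportRpow_eq_rpow {t : ℝ} (ht : t ≠ 0) (x : ℝ) : supportRpow t x = x ^ t := by
  unfold supportRpow
  split_ifs with h
  · rw [h, Real.zero_rpow ht]
  · rfl

lemma supportRpow_nonneg (t : ℝ) {x : ℝ} (hx : 0 ≤ x) : 0 ≤ supportRpow t x := by
  unfold supportRpow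
  split_ifs
  · exact le_rfl
  · exact Real.rpow_nonneg hx t

lemma supportRpow_add (r s : ℝ) {x : ℝ} (hx : 0 ≤ x) :
    supportRpow r x * supportRpow s x = supportRpow (r + s) x := by
  unfold supportRpow
  split_ifs with h
  · simp
  · rw [Real.rpow_add (lt_of_le_of_ne hx (Ne.symm h))]

lemma IsHermitian.matPow_eq_cfc (hA : A.IsHermitian) (t : ℝ) :
    matPow A t = cfc (supportRpow t) A := by
  rw [hA.cfc_eq, IsHermitian.cfc, matPow, dif_pos hA, Unitary.conjStarAlgAut_apply]
  rfl

lemma PosSemidef.eqOn_spectrum_cfc (hA : A.PosSemidef) {f g : ℝ → ℝ}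
    (h : ∀ x, 0 ≤ x → f x = g x) : cfc f A = cfc g A := by
  refine cfc_congr fun x hx => h x ?_
  rw [hA.1.spectrum_real_eq_range_eigenvalues] at hx
  obtain ⟨i, rfl⟩ := hx
  exact hA.eigenvalues_nonneg i

lemma PosSemidef.posSemidef_matPow (hA : A.PosSemidef) (t : ℝ) : (matPow A t).PosSemidef := by
  rw [← nonneg_iff_posSemidef, hA.1.matPow_eq_cfc]
  refine cfc_nonneg fun x hx => supportRpow_nonneg t ?_
  rw [hA.1.spectrum_real_eq_range_eigenvalues] at hx
  obtain ⟨i, rfl⟩ := hx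
  exact hA.eigenvalues_nonneg i

lemma PosSemidef.matPow_mul_matPow (hA : A.PosSemidef) (r s : ℝ) :
    matPow A r * matPow A s = matPow A (r + s) := by
  rw [hA.1.matPow_eq_cfc, hA.1.matPow_eq_cfc, hA.1.matPow_eq_cfc,
    ← cfc_mul _ _ _ (finite_real_spectrum.continuousOn _) (finite_real_spectrum.continuousOn _)]
  exact hA.eqOn_spectrum_cfc fun x hx => supportRpow_add r s hx

lemma PosSemidef.matPow_one (hA : A.PosSemidef) : matPow A 1 = A := by
  rw [hA.1.matPow_eq_cfc]
  conv_rhs => rw [← cfc_id' ℝ A hA.1]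
  exact hA.eqOn_spectrum_cfc fun x _ => by rw [supportRpow_eq_rpow one_ne_zero, Real.rpow_one]

lemma PosSemidef.matPow_eq_rpow (hA : A.PosSemidef) {t : ℝ} (ht : t ≠ 0) :
    matPow A t = A ^ t := by
  rw [hA.1.matPow_eq_cfc, CFC.rpow_eq_cfc_real (nonneg_iff_posSemidef.mpr hA)]
  exact hA.eqOn_spectrum_cfc fun x _ => supportRpow_eq_rpow ht x

/-- The Löwner–Heinz inequality. -/
lemma PosSemidef.matPow_le_matPow (hA : A.PosSemidef) (hB : B.PosSemidef) (hAB : A ≤ B)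
    {p : ℝ} (hp0 : 0 < p) (hp1 : p ≤ 1) : matPow A p ≤ matPow B p := by
  rw [hA.matPow_eq_rpow hp0.ne', hB.matPow_eq_rpow hp0.ne']
  exact CFC.rpow_le_rpow ⟨hp0.le, hp1⟩ hAB

lemma IsHermitian.trace_matPow (hA : A.IsHermitian) (t : ℝ) :
    (matPow A t).trace = ((∑ i, supportRpow t (hA.eigenvalues i) : ℝ) : ℂ) := by
  rw [matPow, dif_pos hA, trace_mul_cycle, Unitary.coe_star_mul_self, one_mul,
    trace_diagonal, Complex.ofReal_sum]
  rfl

lemma trace_matPow_mul_conjTranspose (X : Matrix n n ℂ) (t : ℝ) :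
    (matPow (X * Xᴴ) t).trace = (matPow (Xᴴ * X) t).trace := by
  have h₁ := isHermitian_mul_conjTranspose_self X
  have h₂ := isHermitian_conjTranspose_mul_self X
  rw [h₁.trace_matPow, h₂.trace_matPow,
    (h₁.eigenvalues_eq_eigenvalues_iff h₂).mpr (charpoly_mul_comm _ _)]

lemma conj_unitary_diagonal_apply_self (W : Matrix n n ℂ) (d : n → ℝ) (i : n) :
    (W * diagonal (fun j => (d j : ℂ)) * Wᴴ) i i =
      ((∑ j, Complex.normSq (W i j) * d j : ℝ) : ℂ) := by
  rw [mul_apply]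
  push_cast
  refine Finset.sum_congr rfl fun j _ => ?_
  rw [mul_diagonal, conjTranspose_apply, ← Complex.mul_conj, RCLike.star_def]
  ring

/-- The trace of a power with exponent at least one is monotone. -/
lemma PosSemidef.trace_matPow_mono (hA : A.PosSemidef) (hB : B.PosSemidef) (hAB : A ≤ B)
    {t : ℝ} (ht : 1 ≤ t) :
    (matPow A t).trace.re ≤ (matPow B t).trace.re := by
  have ht0 : t ≠ 0 := by positivity
  set U : Matrix n n ℂ := (hA.1.eigenvectorUnitary : Matrix n n ℂ)
  set V : Matrix n n ℂ := (hB.1.eigenvectorUnitary : Matrix n n ℂ)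
  have hUU : Uᴴ * U = 1 := Unitary.coe_star_mul_self hA.1.eigenvectorUnitary
  have hUU' : U * Uᴴ = 1 := Unitary.coe_mul_star_self hA.1.eigenvectorUnitary
  have hVV' : V * Vᴴ = 1 := Unitary.coe_mul_star_self hB.1.eigenvectorUnitary
  set W : Matrix n n ℂ := Uᴴ * V with hW
  have hWH : Wᴴ = Vᴴ * U := by rw [hW, conjTranspose_mul, conjTranspose_conjTranspose]
  have hWW : W * Wᴴ = 1 := by
    rw [hWH, hW, Matrix.mul_assoc, ← Matrix.mul_assoc V, hVV', Matrix.one_mul, hUU]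
  have hsum : ∀ i, ∑ j, Complex.normSq (W i j) = 1 := fun i => by
    have h := conj_unitary_diagonal_apply_self W (fun _ => 1) i
    simp only [Complex.ofReal_one, diagonal_one, hWW, one_apply_eq, mul_one] at h
    exact_mod_cast h.symm
  have hAd : Uᴴ * A * U = diagonal (fun j => (hA.1.eigenvalues j : ℂ)) := by
    have h : A = U * diagonal (fun j => (hA.1.eigenvalues j : ℂ)) * Uᴴ := by
      conv_lhs => rw [hA.1.spectral_theorem, Unitary.conjStarAlgAut_apply]
      rfl
    refine (congrArg (fun M => Uᴴ * M * U) h).trans ?_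
    simp only [Matrix.mul_assoc, hUU, Matrix.mul_one]
    rw [← Matrix.mul_assoc, hUU, Matrix.one_mul]
  have hBd : Uᴴ * B * U = W * diagonal (fun j => (hB.1.eigenvalues j : ℂ)) * Wᴴ := by
    have h : B = V * diagonal (fun j => (hB.1.eigenvalues j : ℂ)) * Vᴴ := by
      conv_lhs => rw [hB.1.spectral_theorem, Unitary.conjStarAlgAut_apply]
      rfl
    refine (congrArg (fun M => Uᴴ * M * U) h).trans ?_
    rw [hWH]
    simp only [hW, Matrix.mul_assoc]
  have hBt : Uᴴ * matPow B t * U =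
      W * diagonal (fun j => (supportRpow t (hB.1.eigenvalues j) : ℂ)) * Wᴴ := by
    have h : matPow B t =
        V * diagonal (fun j => (supportRpow t (hB.1.eigenvalues j) : ℂ)) * Vᴴ := by
      rw [matPow, dif_pos hB.1]
      rfl
    refine (congrArg (fun M => Uᴴ * M * U) h).trans ?_
    rw [hWH]
    simp only [hW, Matrix.mul_assoc]
  have hle : ∀ i, hA.1.eigenvalues i ≤ ∑ j, Complex.normSq (W i j) * hB.1.eigenvalues j := by
    intro i
    have h := ((le_iff.mp hAB).conjTranspose_mul_mul_same U).diag_nonneg (i := i)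
    rw [Matrix.mul_sub, Matrix.sub_mul, hAd, hBd, sub_apply, conj_unitary_diagonal_apply_self,
      diagonal_apply_eq, sub_nonneg] at h
    exact_mod_cast h
  have htr : (matPow B t).trace =
      ((∑ i, ∑ j, Complex.normSq (W i j) * supportRpow t (hB.1.eigenvalues j) : ℝ) : ℂ) := by
    have h : (matPow B t).trace = (Uᴴ * matPow B t * U).trace := by
      rw [trace_mul_cycle, hUU', Matrix.one_mul]
    rw [h, hBt, trace, Complex.ofReal_sum]
    exact Finset.sum_congr rfl fun i _ => conj_unitary_diagonal_apply_self W _ i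
  rw [hA.1.trace_matPow, htr, Complex.ofReal_re, Complex.ofReal_re]
  refine Finset.sum_le_sum fun i _ => ?_
  simp only [supportRpow_eq_rpow ht0]
  calc hA.1.eigenvalues i ^ t
      ≤ (∑ j, Complex.normSq (W i j) * hB.1.eigenvalues j) ^ t :=
        Real.rpow_le_rpow (hA.eigenvalues_nonneg i) (hle i) (by positivity)
    _ ≤ ∑ j, Complex.normSq (W i j) * hB.1.eigenvalues j ^ t :=
        Real.rpow_arith_mean_le_arith_mean_rpow _ _ _ (fun j _ => Complex.normSq_nonneg _)
          (hsum i) (fun j _ => hB.eigenvalues_nonneg j) ht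

lemma PosSemidef.matPow_half_mul_self (hA : A.PosSemidef) :
    matPow A (1 / 2) * matPow A (1 / 2) = A := by
  rw [hA.matPow_mul_matPow, add_halves, hA.matPow_one]

lemma PosSemidef.trace_sandwich (hA : A.PosSemidef) (hB : B.PosSemidef) (s t : ℝ) :
    (matPow (matPow B s * A * matPow B s) t).trace =
      (matPow
        (matPow A (1 / 2) * matPow B (2 * s) * matPow A (1 / 2)) t).trace := by
  have h := trace_matPow_mul_conjTranspose (matPow B s * matPow A (1 / 2)) t
  rw [conjTranspose_mul, (hB.posSemidef_matPow s).1.eq, (hA.posSemidef_matPow _).1.eq] at h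
  convert h using 3
  · conv_lhs => rw [← hA.matPow_half_mul_self]
    simp only [Matrix.mul_assoc]
  · rw [two_mul, ← hB.matPow_mul_matPow]
    simp only [Matrix.mul_assoc]

lemma PosSemidef.trace_matPow_re_pos (hA : A.PosSemidef) (h : A ≠ 0) (t : ℝ) :
    0 < (matPow A t).trace.re := by
  refine (hA.posSemidef_matPow t).trace_re_pos fun h0 => h ?_
  rw [← hA.matPow_one, ← add_sub_cancel t 1, ← hA.matPow_mul_matPow, h0, Matrix.zero_mul]

lemma PosSemidef.trace_sandwich_pos (hA : A.PosSemidef) (hB : B.PosSemidef)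
    (hAB : A * B ≠ 0) (s t : ℝ) :
    0 < (matPow (matPow B s * A * matPow B s) t).trace.re := by
  have hP := (hB.posSemidef_matPow s).1.eq
  have hR := (hA.posSemidef_matPow (1 / 2)).1.eq
  have hpsd : (matPow B s * A * matPow B s).PosSemidef := by
    simpa only [hP] using hA.conjTranspose_mul_mul_same (matPow B s)
  refine hpsd.trace_matPow_re_pos (fun h0 => hAB ?_) t
  have h1 : matPow A (1 / 2) * matPow B s = 0 := by
    rw [← conjTranspose_mul_self_eq_zero, conjTranspose_mul, hP, hR, ← h0]
    conv_rhs => rw [← hA.matPow_half_mul_self]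
    simp only [Matrix.mul_assoc]
  calc A * B = matPow A (1 / 2) * (matPow A (1 / 2) * matPow B s) *
        matPow B (1 - s) := by
        rw [← Matrix.mul_assoc, hA.matPow_half_mul_self, Matrix.mul_assoc,
          hB.matPow_mul_matPow, add_sub_cancel, hB.matPow_one]
    _ = 0 := by rw [h1, Matrix.mul_zero, Matrix.zero_mul]

lemma PosSemidef.trace_mul_re_mono {R : Matrix n n ℂ} (hR : R.PosSemidef) (hAB : A ≤ B) :
    (R * A).trace.re ≤ (R * B).trace.re := by
  have h := trace_re_mono (star_left_conjugate_le_conjugate hAB (matPow R (1 / 2)))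
  have key : ∀ X : Matrix n n ℂ,
      (star (matPow R (1 / 2)) * X * matPow R (1 / 2)).trace = (R * X).trace := by
    intro X
    rw [star_eq_conjTranspose, (hR.posSemidef_matPow _).1.eq, trace_mul_cycle,
      hR.matPow_half_mul_self]
  rwa [key, key] at h

lemma PosSemidef.trace_mul_nonneg {R : Matrix n n ℂ} (hR : R.PosSemidef) (hA : A.PosSemidef) :
    0 ≤ (R * A).trace := by
  have h := hA.conjTranspose_mul_mul_same (matPow R (1 / 2))
  have h2 := h.trace_nonneg
  rwa [(hR.posSemidef_matPow _).1.eq, trace_mul_cycle, hR.matPow_half_mul_self] at h2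

/-- The support projection of a dominating matrix fixes the square root of the dominated one. -/
lemma PosSemidef.matPow_zero_mul_of_dominates (hB : B.PosSemidef) (hA : A.PosSemidef)
    (h : dominates B A) :
    matPow B 0 * matPow A (1 / 2) = matPow A (1 / 2) := by
  have hP := (hB.posSemidef_matPow 0).1.eq
  have hR := (hA.posSemidef_matPow (1 / 2)).1.eq
  have hBP : B * (1 - matPow B 0) = 0 := by
    have : B * matPow B 0 = B := by
      nth_rewrite 1 [← hB.matPow_one]
      rw [hB.matPow_mul_matPow, add_zero, hB.matPow_one]
    rw [Matrix.mul_sub, Matrix.mul_one, this, sub_self]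
  have hAP : A * (1 - matPow B 0) = 0 := by
    refine Matrix.ext_of_mulVec_single fun i => ?_
    rw [← mulVec_mulVec, zero_mulVec]
    apply h
    rw [mulVec_mulVec, hBP, zero_mulVec]
  have hRP : matPow A (1 / 2) * (1 - matPow B 0) = 0 := by
    rw [← conjTranspose_mul_self_eq_zero, conjTranspose_mul, hR, Matrix.mul_assoc,
      ← Matrix.mul_assoc (matPow A (1 / 2)), hA.matPow_half_mul_self, hAP, Matrix.mul_zero]
  have := congrArg Matrix.conjTranspose hRP
  rw [conjTranspose_mul, conjTranspose_sub, conjTranspose_one, hP, hR, Matrix.sub_mul,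
    Matrix.one_mul, conjTranspose_zero, sub_eq_zero] at this
  exact this.symm

end

end Matrix

open scoped MatrixOrder in
open Matrix in
/-- the sandwiched Rényi divergence is antitone in its second argument
with respect to the Loewner order. -/
theorem stmt4 {n : ℕ} {α : ℝ}
    (hα : (1 / 2 ≤ α ∧ α < 1) ∨ 1 < α)
    {ρ σ σ' : Matrix (Fin n) (Fin n) ℂ}
    (hρ : ρ.PosSemidef) (hρ0 : ρ ≠ 0) (hσ : σ.PosSemidef) (hσ' : σ'.PosSemidef)
    (hle : (σ' - σ).PosSemidef) :
    Dtilde α ρ σ' ≤ Dtilde α ρ σ := by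
  have hle' : σ ≤ σ' := hle
  by_cases hc : (ρ * σ).trace ≠ 0 ∧ (dominates σ ρ ∨ α < 1)
  swap
  · rw [Dtilde, Dtilde, if_neg hc]
    exact le_top
  have htr : (ρ * σ').trace ≠ 0 := by
    have hpos : 0 < (ρ * σ).trace := lt_of_le_of_ne (hρ.trace_mul_nonneg hσ) hc.1.symm
    have h := hρ.trace_mul_re_mono hle'
    intro h0
    rw [h0] at h
    exact absurd (Complex.lt_def.mp hpos).1 (not_lt.mpr h)
  have hdom : dominates σ ρ → dominates σ' ρ := fun hd v hv =>
    hd v (hσ.mulVec_eq_zero_of_le hle' hv)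
  have hne : ρ * σ ≠ 0 := fun h => hc.1 (by rw [h, trace_zero])
  have hne' : ρ * σ' ≠ 0 := fun h => htr (by rw [h, trace_zero])
  have hQ := hρ.trace_sandwich_pos hσ hne ((1 - α) / (2 * α)) α
  have hQ' := hρ.trace_sandwich_pos hσ' hne' ((1 - α) / (2 * α)) α
  have hT := hρ.trace_re_pos hρ0
  rw [Dtilde, Dtilde, if_pos hc, if_pos ⟨htr, hc.2.imp_left hdom⟩, EReal.coe_le_coe_iff]
  have hα0 : 0 < α := by rcases hα with h | h <;> linarith [h]
  have hR := (hρ.posSemidef_matPow (1 / 2)).1.eq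
  have hs : 2 * ((1 - α) / (2 * α)) = (1 - α) / α := by field_simp
  have hconj : ∀ X : Matrix (Fin n) (Fin n) ℂ, X.PosSemidef →
      (matPow ρ (1 / 2) * X * matPow ρ (1 / 2)).PosSemidef := fun X hX => by
    simpa only [hR] using hX.conjTranspose_mul_mul_same (matPow ρ (1 / 2))
  rcases hα with ⟨hα1, hα2⟩ | hα1
  · refine mul_le_mul_of_nonpos_left ?_ (inv_nonpos.mpr (by linarith))
    refine Real.logb_le_logb_of_le one_lt_two (div_pos hQ hT) ?_
    refine div_le_div_of_nonneg_right ?_ hT.le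
    rw [hρ.trace_sandwich hσ, hρ.trace_sandwich hσ', hs]
    refine trace_re_mono (PosSemidef.matPow_le_matPow (hconj _ (hσ.posSemidef_matPow _))
      (hconj _ (hσ'.posSemidef_matPow _)) ?_ hα0 hα2.le)
    have h := star_left_conjugate_le_conjugate (hσ.matPow_le_matPow hσ' hle'
      (p := (1 - α) / α) (div_pos (by linarith) hα0) (by rw [div_le_one hα0]; linarith))
      (matPow ρ (1 / 2))
    rwa [star_eq_conjTranspose, hR] at h
  · have hd : dominates σ ρ := hc.2.resolve_right (not_lt.mpr hα1.le)
    refine mul_le_mul_of_nonneg_left ?_ (inv_nonneg.mpr (by linarith))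
    refine Real.logb_le_logb_of_le one_lt_two (div_pos hQ' hT) ?_
    refine div_le_div_of_nonneg_right ?_ hT.le
    rw [hρ.trace_sandwich hσ, hρ.trace_sandwich hσ', hs]
    refine (hconj _ (hσ'.posSemidef_matPow _)).trace_matPow_mono
      (hconj _ (hσ.posSemidef_matPow _)) ?_ hα1.le
    have hp : (1 - α) / α = -((α - 1) / α) := by ring
    have hmono := hσ.matPow_le_matPow hσ' hle' (p := (α - 1) / α) (div_pos (by linarith) hα0)
      (by rw [div_le_one hα0]; linarith)
    have hsolve : ∀ τ : Matrix (Fin n) (Fin n) ℂ, τ.PosSemidef → dominates τ ρ →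
        matPow τ ((α - 1) / α) * (matPow τ ((1 - α) / α) * matPow ρ (1 / 2)) =
          matPow ρ (1 / 2) := fun τ hτ hτρ => by
      rw [← Matrix.mul_assoc, hτ.matPow_mul_matPow, hp, add_neg_cancel,
        hτ.matPow_zero_mul_of_dominates hρ hτρ]
    have h := (hσ.posSemidef_matPow _).conjTranspose_mul_le_of_mul_eq
      (hσ'.posSemidef_matPow _) hmono
      (hsolve σ hσ hd) (hsolve σ' hσ' (hdom hd))
    rwa [hR, ← Matrix.mul_assoc, ← Matrix.mul_assoc] at h
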